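/- arXiv:hep-th/0608126 — 2 statements merged into one kernel-verified Lean document; each statement's English description precedes it below -/
import Mathlib

section
/- For every ε_1 ≠ 0, the Killing form of g_{−1}(ε_1) has signature 2, i.e. exactly 5 positive and 3 negative eigenvalues; its spectrum with respect to the basis X_1,…,X_8 is {4, 6, −6, 12, 6ε_1, 6ε_1, −6ε_1, −6ε_1}. -/
/-- The underlying space `ℝ⁸` of the family `g_α`. -/
abbrev V8 : Type := Fin 8 → ℝ

/-- The standard basis vector `X_{k+1}` (0-indexed: `e8 k`). -/
def e8 (k : Fin 8) : V8 := fun l => if l = k then 1 else 0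

/-- Brackets of basis elements of `g_α` for `i < j` (0-indexed, `X_{i+1} = e8 i`):
`u α i j = [X_{i+1}, X_{j+1}]`. -/
noncomputable def gUpper (α : ℝ) : Fin 8 → Fin 8 → V8 := fun i j =>
  match (i : ℕ), (j : ℕ) with
  | 0, 1 => (2 : ℝ) • e8 1          -- [X₁,X₂] = 2X₂
  | 0, 2 => (-2 : ℝ) • e8 2         -- [X₁,X₃] = −2X₃
  | 1, 2 => e8 0                    -- [X₂,X₃] = X₁
  | 0, 3 => e8 3                    -- [X₁,X₄] = X₄
  | 0, 4 => -e8 4                   -- [X₁,X₅] = −X₅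
  | 0, 5 => e8 5                    -- [X₁,X₆] = X₆
  | 0, 6 => -e8 6                   -- [X₁,X₇] = −X₇
  | 1, 4 => e8 3                    -- [X₂,X₅] = X₄
  | 1, 6 => e8 5                    -- [X₂,X₇] = X₆
  | 2, 3 => e8 4                    -- [X₃,X₄] = X₅
  | 2, 5 => e8 6                    -- [X₃,X₆] = X₇
  | 3, 7 => e8 3                    -- [X₄,X₈] = X₄
  | 4, 7 => e8 4                    -- [X₅,X₈] = X₅
  | 5, 7 => α • e8 5                -- [X₆,X₈] = αX₆
  | 6, 7 => α • e8 6                -- [X₇,X₈] = αX₇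
  | _, _ => 0

/-- The structure constants `C_{ij}^k` of `g_α`. -/
noncomputable def gC (α : ℝ) (i j k : Fin 8) : ℝ := gUpper α i j k - gUpper α j i k

/-- The bilinear map on `ℝ⁸` with structure constants `C`. -/
noncomputable def brOf (C : Fin 8 → Fin 8 → Fin 8 → ℝ) : V8 →ₗ[ℝ] V8 →ₗ[ℝ] V8 :=
  LinearMap.mk₂ ℝ (fun x y k => ∑ i, ∑ j, C i j k * x i * y j)
    (by
      intro x x' y
      funext k
      simp only [Pi.add_apply]
      rw [← Finset.sum_add_distrib]
      refine Finset.sum_congr rfl fun i _ => ?_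
      rw [← Finset.sum_add_distrib]
      exact Finset.sum_congr rfl fun j _ => by ring)
    (by
      intro c x y
      funext k
      simp only [Pi.smul_apply, smul_eq_mul]
      rw [Finset.mul_sum]
      refine Finset.sum_congr rfl fun i _ => ?_
      rw [Finset.mul_sum]
      exact Finset.sum_congr rfl fun j _ => by ring)
    (by
      intro x y y'
      funext k
      simp only [Pi.add_apply]
      rw [← Finset.sum_add_distrib]
      refine Finset.sum_congr rfl fun i _ => ?_
      rw [← Finset.sum_add_distrib]
      exact Finset.sum_congr rfl fun j _ => by ring)
    (by
      intro c x y
      funext k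
      simp only [Pi.smul_apply, smul_eq_mul]
      rw [Finset.mul_sum]
      refine Finset.sum_congr rfl fun i _ => ?_
      rw [Finset.mul_sum]
      exact Finset.sum_congr rfl fun j _ => by ring)

/-- The Lie bracket `μ_α` of the Lie algebra `g_α`, as a bilinear map on `ℝ⁸`. -/
noncomputable def brA (α : ℝ) : V8 →ₗ[ℝ] V8 →ₗ[ℝ] V8 := brOf (gC α)

/-- Values `φ₁(X_{i+1}, X_{j+1})` for `i < j` (0-indexed). -/
noncomputable def phi1Upper : Fin 8 → Fin 8 → V8 := fun i j =>
  match (i : ℕ), (j : ℕ) with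
  | 3, 5 => e8 1                                        -- φ₁(X₄,X₆) = X₂
  | 3, 6 => (-(1:ℝ)/2) • e8 0 + ((3:ℝ)/2) • e8 7        -- φ₁(X₄,X₇) = −½X₁+³⁄₂X₈
  | 4, 5 => (-(1:ℝ)/2) • e8 0 - ((3:ℝ)/2) • e8 7        -- φ₁(X₅,X₆) = −½X₁−³⁄₂X₈
  | 4, 6 => -e8 2                                       -- φ₁(X₅,X₇) = −X₃
  | _, _ => 0

/-- The alternating bilinear map `φ₁` on `ℝ⁸`. -/
noncomputable def phi1 : V8 →ₗ[ℝ] V8 →ₗ[ℝ] V8 :=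
  brOf (fun i j k => phi1Upper i j k - phi1Upper j i k)

/-- Values `φ₂(X_{i+1}, X_{j+1})` for `i < j` (0-indexed). -/
noncomputable def phi2Upper : Fin 8 → Fin 8 → V8 := fun i j =>
  match (i : ℕ), (j : ℕ) with
  | 5, 7 => e8 5                                        -- φ₂(X₆,X₈) = X₆
  | 6, 7 => e8 6                                        -- φ₂(X₇,X₈) = X₇
  | _, _ => 0

/-- The alternating bilinear map `φ₂` on `ℝ⁸`. -/
noncomputable def phi2 : V8 →ₗ[ℝ] V8 →ₗ[ℝ] V8 :=
  brOf (fun i j k => phi2Upper i j k - phi2Upper j i k)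

/-- The bracket of the deformed Lie algebra `g_{−1}(ε₁) = (ℝ⁸, μ_{−1} + ε₁φ₁)`. -/
noncomputable def brD (ε₁ : ℝ) : V8 →ₗ[ℝ] V8 →ₗ[ℝ] V8 := brA (-1) + ε₁ • phi1

/-- The Killing form `κ(x,y) = tr(ad x ∘ ad y)` of `g_{−1}(ε₁)`. -/
noncomputable def killing (ε₁ : ℝ) (x y : V8) : ℝ :=
  LinearMap.trace ℝ V8 ((brD ε₁ x) ∘ₗ (brD ε₁ y))

/-- The matrix of the Killing form of `g_{−1}(ε₁)` in the basis `X₁,…,X₈`. -/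
noncomputable def killingMat (ε₁ : ℝ) : Matrix (Fin 8) (Fin 8) ℝ :=
  Matrix.of fun i j => killing ε₁ (e8 i) (e8 j)

/-- Integer coordinates of the standard basis vector `e8 k`. -/
def intBasis (k l : Fin 8) : ℤ := if l = k then 1 else 0

/-- Integer coordinates of the brackets of basis elements of `g_{-1}`. -/
def intUpper : Fin 8 → Fin 8 → Fin 8 → ℤ := fun i j k =>
  match (i : ℕ), (j : ℕ) with
  | 0, 1 => 2 * intBasis 1 k
  | 0, 2 => -2 * intBasis 2 k
  | 1, 2 => intBasis 0 k
  | 0, 3 => intBasis 3 k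
  | 0, 4 => -intBasis 4 k
  | 0, 5 => intBasis 5 k
  | 0, 6 => -intBasis 6 k
  | 1, 4 => intBasis 3 k
  | 1, 6 => intBasis 5 k
  | 2, 3 => intBasis 4 k
  | 2, 5 => intBasis 6 k
  | 3, 7 => intBasis 3 k
  | 4, 7 => intBasis 4 k
  | 5, 7 => -intBasis 5 k
  | 6, 7 => -intBasis 6 k
  | _, _ => 0

/-- Integer coordinates of twice the values of `φ₁` on basis elements. -/
def intPhiUpper : Fin 8 → Fin 8 → Fin 8 → ℤ := fun i j k =>
  match (i : ℕ), (j : ℕ) with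
  | 3, 5 => 2 * intBasis 1 k
  | 3, 6 => -intBasis 0 k + 3 * intBasis 7 k
  | 4, 5 => -intBasis 0 k - 3 * intBasis 7 k
  | 4, 6 => -2 * intBasis 2 k
  | _, _ => 0

/-- Integer structure constants of `g_{-1}`. -/
def intC (i j k : Fin 8) : ℤ := intUpper i j k - intUpper j i k

/-- Integer structure constants of `2 φ₁`. -/
def intPhi (i j k : Fin 8) : ℤ := intPhiUpper i j k - intPhiUpper j i k

theorem e8_apply_eq_intBasis (k l : Fin 8) : e8 k l = (intBasis k l : ℝ) := by
  simp [e8, intBasis]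

theorem gC_eq_intC (i j k : Fin 8) : gC (-1) i j k = (intC i j k : ℝ) := by
  have h (i j : Fin 8) : gUpper (-1) i j k = (intUpper i j k : ℝ) := by
    unfold gUpper intUpper
    split <;> simp [*, e8_apply_eq_intBasis]
  simp [gC, intC, h]

theorem phi1Upper_eq_intPhi (i j k : Fin 8) :
    phi1Upper i j k - phi1Upper j i k = (intPhi i j k : ℝ) / 2 := by
  have h (i j : Fin 8) : phi1Upper i j k = (intPhiUpper i j k : ℝ) / 2 := by
    unfold phi1Upper intPhiUpper
    split <;> simp [*, e8_apply_eq_intBasis] <;> ring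
  simp only [h, intPhi, Int.cast_sub]
  ring

theorem brOf_e8 (C : Fin 8 → Fin 8 → Fin 8 → ℝ) (i j k : Fin 8) :
    brOf C (e8 i) (e8 j) k = C i j k := by
  simp [brOf, e8]

theorem brD_e8 (ε₁ : ℝ) (i j k : Fin 8) :
    brD ε₁ (e8 i) (e8 j) k = intC i j k + ε₁ * (intPhi i j k / 2) := by
  simp [brD, brA, phi1, brOf_e8, gC_eq_intC, phi1Upper_eq_intPhi]

theorem killing_eq_sum (ε₁ : ℝ) (x y : V8) :
    killing ε₁ x y = ∑ a, ∑ b, brD ε₁ x (e8 a) b * brD ε₁ y (e8 b) a := by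
  have h (a : Fin 8) : (Pi.single a 1 : V8) = e8 a := by
    ext l
    simp [e8, Pi.single_apply]
  rw [killing, LinearMap.trace_eq_matrix_trace ℝ (Pi.basisFun ℝ (Fin 8)),
    LinearMap.toMatrix_comp _ (Pi.basisFun ℝ (Fin 8)), Matrix.trace_mul_comm]
  simp only [Matrix.trace, Matrix.diag_apply, Matrix.mul_apply, LinearMap.toMatrix_apply,
    Pi.basisFun_apply, Pi.basisFun_repr, h]
  exact Finset.sum_congr rfl fun a _ => Finset.sum_congr rfl fun b _ => mul_comm _ _

/-- The Killing matrix of `g_{-1}`. -/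
def intKilling : Fin 8 → Fin 8 → ℤ :=
  ![![12, 0, 0, 0, 0, 0, 0, 0],
    ![0, 0, 6, 0, 0, 0, 0, 0],
    ![0, 6, 0, 0, 0, 0, 0, 0],
    ![0, 0, 0, 0, 0, 0, 0, 0],
    ![0, 0, 0, 0, 0, 0, 0, 0],
    ![0, 0, 0, 0, 0, 0, 0, 0],
    ![0, 0, 0, 0, 0, 0, 0, 0],
    ![0, 0, 0, 0, 0, 0, 0, 4]]

/-- The coefficient of `ε₁` in the Killing matrix of `g_{-1}(ε₁)`. -/
def intKillingDeform : Fin 8 → Fin 8 → ℤ :=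
  ![![0, 0, 0, 0, 0, 0, 0, 0],
    ![0, 0, 0, 0, 0, 0, 0, 0],
    ![0, 0, 0, 0, 0, 0, 0, 0],
    ![0, 0, 0, 0, 0, 0, -6, 0],
    ![0, 0, 0, 0, 0, 6, 0, 0],
    ![0, 0, 0, 0, 6, 0, 0, 0],
    ![0, 0, 0, -6, 0, 0, 0, 0],
    ![0, 0, 0, 0, 0, 0, 0, 0]]

theorem sum_intC_mul_intC :
    ∀ i j, ∑ a, ∑ b, intC i a b * intC j b a = intKilling i j := by
  decide +kernel

theorem sum_intC_mul_intPhi :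
    ∀ i j, ∑ a, ∑ b, (intC i a b * intPhi j b a + intPhi i a b * intC j b a) =
      2 * intKillingDeform i j := by
  decide +kernel

theorem sum_intPhi_mul_intPhi :
    ∀ i j, ∑ a, ∑ b, intPhi i a b * intPhi j b a = 0 := by
  decide +kernel

theorem killingMat_apply (ε₁ : ℝ) (i j : Fin 8) :
    killingMat ε₁ i j = intKilling i j + ε₁ * intKillingDeform i j := by
  have h0 := congrArg (Int.cast : ℤ → ℝ) (sum_intC_mul_intC i j)
  have h1 := congrArg (Int.cast : ℤ → ℝ) (sum_intC_mul_intPhi i j)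
  have h2 := congrArg (Int.cast : ℤ → ℝ) (sum_intPhi_mul_intPhi i j)
  push_cast at h0 h1 h2
  have expand : killingMat ε₁ i j =
      (∑ a, ∑ b, (intC i a b : ℝ) * intC j b a) +
      ε₁ / 2 * (∑ a, ∑ b, ((intC i a b : ℝ) * intPhi j b a + intPhi i a b * intC j b a)) +
      ε₁ ^ 2 / 4 * (∑ a, ∑ b, (intPhi i a b : ℝ) * intPhi j b a) := by
    simp only [killingMat, Matrix.of_apply, killing_eq_sum, brD_e8, Finset.mul_sum,
      ← Finset.sum_add_distrib]
    exact Finset.sum_congr rfl fun a _ => Finset.sum_congr rfl fun b _ => by ring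
  rw [expand, h0, h1, h2]
  ring

/-- A matrix whose columns are eigenvectors of the Killing matrix of `g_{-1}(ε₁)`. -/
def killingEigenbasis : Matrix (Fin 8) (Fin 8) ℝ :=
  !![1, 0, 0, 0, 0, 0, 0, 0;
     0, 1, 1, 0, 0, 0, 0, 0;
     0, 1, -1, 0, 0, 0, 0, 0;
     0, 0, 0, 1, 0, 0, 1, 0;
     0, 0, 0, 0, 1, 1, 0, 0;
     0, 0, 0, 0, 1, -1, 0, 0;
     0, 0, 0, 1, 0, 0, -1, 0;
     0, 0, 0, 0, 0, 0, 0, 1]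

/-- The inverse of `killingEigenbasis`. -/
noncomputable def killingEigenbasisInv : Matrix (Fin 8) (Fin 8) ℝ :=
  !![1, 0, 0, 0, 0, 0, 0, 0;
     0, 1/2, 1/2, 0, 0, 0, 0, 0;
     0, 1/2, -1/2, 0, 0, 0, 0, 0;
     0, 0, 0, 1/2, 0, 0, 1/2, 0;
     0, 0, 0, 0, 1/2, 1/2, 0, 0;
     0, 0, 0, 0, 1/2, -1/2, 0, 0;
     0, 0, 0, 1/2, 0, 0, -1/2, 0;
     0, 0, 0, 0, 0, 0, 0, 1]

theorem killingEigenbasisInv_mul : killingEigenbasisInv * killingEigenbasis = 1 := by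
  ext i j
  fin_cases i <;> fin_cases j <;>
    simp [killingEigenbasis, killingEigenbasisInv, Matrix.mul_apply, Fin.sum_univ_eight] <;>
    norm_num

theorem killingMat_eq_conj_diagonal (ε₁ : ℝ) :
    killingMat ε₁ = killingEigenbasis *
      Matrix.diagonal ![12, 6, -6, -6 * ε₁, 6 * ε₁, -6 * ε₁, 6 * ε₁, 4] *
      killingEigenbasisInv := by
  ext i j
  rw [killingMat_apply, Matrix.mul_apply]
  simp only [Matrix.mul_diagonal]
  fin_cases i <;> fin_cases j <;>
    simp [killingEigenbasis, killingEigenbasisInv, Fin.sum_univ_eight, intKilling,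
      intKillingDeform] <;> ring

theorem killingMat_charpoly (ε₁ : ℝ) :
    (killingMat ε₁).charpoly =
      (Matrix.diagonal ![12, 6, -6, -6 * ε₁, 6 * ε₁, -6 * ε₁, 6 * ε₁, 4]).charpoly := by
  rw [killingMat_eq_conj_diagonal, Matrix.charpoly_mul_comm, ← Matrix.mul_assoc,
    killingEigenbasisInv_mul, Matrix.one_mul]

open Polynomial in
/-- For `ε₁ ≠ 0` the spectrum of the Killing matrix of `g_{−1}(ε₁)` is
`{4, 6, −6, 12, 6ε₁, 6ε₁, −6ε₁, −6ε₁}` and the Killing form has signature 2: exactly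
5 positive and 3 negative eigenvalues. -/
theorem killing_spectrum_and_signature (ε₁ : ℝ) (hε : ε₁ ≠ 0) :
    (killingMat ε₁).charpoly =
      (((↑[(4:ℝ), 6, -6, 12, 6*ε₁, 6*ε₁, -6*ε₁, -6*ε₁] : Multiset ℝ)).map
        fun r => X - C r).prod ∧
    ((↑[(4:ℝ), 6, -6, 12, 6*ε₁, 6*ε₁, -6*ε₁, -6*ε₁] : Multiset ℝ).filter
      fun r => 0 < r).card = 5 ∧
    ((↑[(4:ℝ), 6, -6, 12, 6*ε₁, 6*ε₁, -6*ε₁, -6*ε₁] : Multiset ℝ).filter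
      fun r => r < 0).card = 3 := by
  refine ⟨?_, ?_⟩
  · rw [killingMat_charpoly, Matrix.charpoly_diagonal]
    simp [Fin.prod_univ_eight]
    ring
  · rcases lt_or_gt_of_ne hε with h | h
    · have h₁ : 6 * ε₁ < 0 := by linarith
      norm_num [Multiset.filter_coe, List.filter_cons, h₁, h₁.not_gt]
    · have h₁ : 0 < 6 * ε₁ := by linarith
      norm_num [Multiset.filter_coe, List.filter_cons, h₁, h₁.not_gt]
end

section
/- For every ε_1 ≠ 0, the Lie algebra g_{−1}(ε_1) is isomorphic to sl(3,ℝ), the Lie algebra of traceless real 3×3 matrices. -/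
/-- The traceless matrix with coordinates `x` in the basis of `sl(3,ℝ)` corresponding to
`X₁, …, X₈`, where `X₆` and `X₇` are rescaled by `ε`. -/
noncomputable def sl3Matrix (ε : ℝ) (x : V8) : Matrix (Fin 3) (Fin 3) ℝ :=
  !![x 0 - x 7 / 3, x 1, x 3;
     x 2, -x 0 - x 7 / 3, x 4;
     -ε * x 6, ε * x 5, 2 * x 7 / 3]

theorem trace_sl3Matrix (ε : ℝ) (x : V8) : (sl3Matrix ε x).trace = 0 := by
  simp only [sl3Matrix, Matrix.trace_fin_three_of]
  ring

/-- The linear equivalence `ℝ⁸ ≃ sl(3,ℝ)` given by `sl3Matrix`. -/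
noncomputable def sl3Equiv (ε : ℝ) (hε : ε ≠ 0) :
    V8 ≃ₗ[ℝ] ↥(LieAlgebra.SpecialLinear.sl (Fin 3) ℝ) where
  toFun x := ⟨sl3Matrix ε x, LinearMap.mem_ker.2 (trace_sl3Matrix ε x)⟩
  map_add' x y := by
    apply Subtype.ext
    ext i j
    fin_cases i <;> fin_cases j <;> simp [sl3Matrix] <;> ring
  map_smul' c x := by
    apply Subtype.ext
    ext i j
    fin_cases i <;> fin_cases j <;> simp [sl3Matrix] <;> ring
  invFun A := ![(A.1 0 0 - A.1 1 1) / 2, A.1 0 1, A.1 1 0, A.1 0 2, A.1 1 2,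
    A.1 2 1 / ε, -A.1 2 0 / ε, 3 / 2 * A.1 2 2]
  left_inv x := by
    ext k
    fin_cases k <;> simp [sl3Matrix] <;> field_simp
  right_inv A := by
    have h : A.1 0 0 + A.1 1 1 + A.1 2 2 = 0 :=
      (Matrix.trace_fin_three A.1).symm.trans (LinearMap.mem_ker.1 A.2)
    apply Subtype.ext
    ext i j
    fin_cases i <;> fin_cases j <;> simp [sl3Matrix] <;> field_simp <;> linarith

theorem gUpper_eq (α : ℝ) : gUpper α =
    ![![0, (2 : ℝ) • e8 1, (-2 : ℝ) • e8 2, e8 3, -e8 4, e8 5, -e8 6, 0],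
      ![0, 0, e8 0, 0, e8 3, 0, e8 5, 0],
      ![0, 0, 0, e8 4, 0, e8 6, 0, 0],
      ![0, 0, 0, 0, 0, 0, 0, e8 3],
      ![0, 0, 0, 0, 0, 0, 0, e8 4],
      ![0, 0, 0, 0, 0, 0, 0, α • e8 5],
      ![0, 0, 0, 0, 0, 0, 0, α • e8 6],
      0] := by
  ext i j : 2
  fin_cases i <;> fin_cases j <;> rfl

theorem brA_neg_one_apply (x y : V8) : brA (-1) x y =
    ![x 1 * y 2 - x 2 * y 1,
      2 * (x 0 * y 1 - x 1 * y 0),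
      -2 * (x 0 * y 2 - x 2 * y 0),
      x 0 * y 3 - x 3 * y 0 + (x 1 * y 4 - x 4 * y 1) + (x 3 * y 7 - x 7 * y 3),
      -(x 0 * y 4 - x 4 * y 0) + (x 2 * y 3 - x 3 * y 2) + (x 4 * y 7 - x 7 * y 4),
      x 0 * y 5 - x 5 * y 0 + (x 1 * y 6 - x 6 * y 1) - (x 5 * y 7 - x 7 * y 5),
      -(x 0 * y 6 - x 6 * y 0) + (x 2 * y 5 - x 5 * y 2) - (x 6 * y 7 - x 7 * y 6),
      0] := by
  ext k
  fin_cases k <;>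
    simp [brA, brOf, gC, gUpper_eq, e8, Fin.sum_univ_eight] <;> ring

theorem phi1_apply (x y : V8) : phi1 x y =
    ![-(1 / 2) * (x 3 * y 6 - x 6 * y 3) - 1 / 2 * (x 4 * y 5 - x 5 * y 4),
      x 3 * y 5 - x 5 * y 3,
      -(x 4 * y 6 - x 6 * y 4),
      0, 0, 0, 0,
      3 / 2 * (x 3 * y 6 - x 6 * y 3) - 3 / 2 * (x 4 * y 5 - x 5 * y 4)] := by
  ext k
  fin_cases k <;>
    simp [phi1, brOf, phi1Upper, e8, Fin.sum_univ_eight] <;> ring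

theorem sl3Matrix_bracket (ε : ℝ) (x y : V8) :
    sl3Matrix ε ((brA (-1) + ε • phi1) x y) = ⁅sl3Matrix ε x, sl3Matrix ε y⁆ := by
  rw [LinearMap.add_apply, LinearMap.add_apply, LinearMap.smul_apply, LinearMap.smul_apply,
    brA_neg_one_apply, phi1_apply, Ring.lie_def]
  ext i j
  fin_cases i <;> fin_cases j <;>
    simp [sl3Matrix] <;> ring

/-- For every `ε₁ ≠ 0`, the deformed Lie algebra `g_{−1}(ε₁) = (ℝ⁸, μ_{−1} + ε₁φ₁)` is
isomorphic to `sl(3,ℝ)`, the Lie algebra of traceless real 3×3 matrices. -/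
theorem deformed_algebra_iso_sl3 (ε₁ : ℝ) (hε : ε₁ ≠ 0) :
    ∃ e : V8 ≃ₗ[ℝ] ↥(LieAlgebra.SpecialLinear.sl (Fin 3) ℝ),
      ∀ x y : V8, e ((brA (-1) + ε₁ • phi1) x y) = ⁅e x, e y⁆ :=
  ⟨sl3Equiv ε₁ hε, fun x y => Subtype.ext (sl3Matrix_bracket ε₁ x y)⟩
end
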